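/- Assume f satisfies (f1'), (f2'), (f3'), and in addition (F/f)'(s) ≥ (n−2)/(2n) for all s > 0. Then there is no nonconstant C² solution u of u''(r) + ((n−1)/r)u'(r) + f(u(r)) = 0 on (0,∞) with u'(0) = 0 and lim_{r→∞} u(r) = 0 having only finitely many zeros in (0,∞). -/

import Mathlib

open Set Filter MeasureTheory

namespace Paper

noncomputable section

/-- `F s = ∫₀ˢ f t dt`. -/
def Fint (f : ℝ → ℝ) (s : ℝ) : ℝ := ∫ t in (0:ℝ)..s, f t

/-- Hypothesis (f1): `f` is odd, `f 0 = 0`, there are `β > b > 0` with `f > 0` on `(b,∞)`,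
`f ≤ 0`, `f ≢ 0` on `[0,b]`, and `F β = 0`. -/
def Hf1 (f : ℝ → ℝ) (b β : ℝ) : Prop :=
  (∀ s, f (-s) = -f s) ∧ f 0 = 0 ∧ 0 < b ∧ b < β ∧
    (∀ s, b < s → 0 < f s) ∧ (∀ s ∈ Icc (0:ℝ) b, f s ≤ 0) ∧
    (∃ s ∈ Icc (0:ℝ) b, f s ≠ 0) ∧ Fint f β = 0

/-- Hypothesis (f2): `f` continuous on `[0,∞)`, C¹ on `(0,∞)`, `f' ∈ L¹(0,1)`. -/
def Hf2 (f : ℝ → ℝ) : Prop :=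
  ContinuousOn f (Ici 0) ∧ (∀ s : ℝ, 0 < s → DifferentiableAt ℝ f s) ∧
    ContinuousOn (deriv f) (Ioi 0) ∧ IntegrableOn (deriv f) (Ioo 0 1)

/-- Hypothesis (f3): `f s ≥ f' s * (s - β)` for `s ≥ β`. -/
def Hf3 (f : ℝ → ℝ) (β : ℝ) : Prop := ∀ s, β ≤ s → deriv f s * (s - β) ≤ f s

/-- Hypothesis (f4): `(F/f)' s ≥ (n-2)/(2n)` for `s > β`. -/
def Hf4 (n : ℕ) (f : ℝ → ℝ) (β : ℝ) : Prop :=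
  ∀ s, β < s → ((n : ℝ) - 2) / (2 * (n : ℝ)) ≤ deriv (fun t => Fint f t / f t) s

/-- Hypothesis (f4'): `(F/f)' s ≥ (n-2)/2` for `s > β`. -/
def Hf4' (n : ℕ) (f : ℝ → ℝ) (β : ℝ) : Prop :=
  ∀ s, β < s → ((n : ℝ) - 2) / 2 ≤ deriv (fun t => Fint f t / f t) s

/-- Hypothesis (f5): `s ↦ s f' s / f s` is nonincreasing on `[β,∞)`. -/
def Hf5 (f : ℝ → ℝ) (β : ℝ) : Prop := AntitoneOn (fun s => s * deriv f s / f s) (Ici β)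

/-- Hypothesis (f6): `β f' β / f β ≤ n/(n-2)`. -/
def Hf6 (n : ℕ) (f : ℝ → ℝ) (β : ℝ) : Prop := β * deriv f β / f β ≤ (n : ℝ) / ((n : ℝ) - 2)

/-- Hypothesis (f1'): `f 0 = 0` and `s f s > 0` for `s > 0`. -/
def Hf1' (f : ℝ → ℝ) : Prop := f 0 = 0 ∧ ∀ s : ℝ, 0 < s → 0 < s * f s

/-- Hypothesis (f3'): `f s ≥ s f' s` for `s > 0`, with strict inequality at points
arbitrarily close to `0`. -/
def Hf3' (f : ℝ → ℝ) : Prop :=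
  (∀ s : ℝ, 0 < s → s * deriv f s ≤ f s) ∧
    ∀ ε : ℝ, 0 < ε → ∃ s ∈ Ioo (0:ℝ) ε, s * deriv f s < f s

/-- `v` is a C² solution of (E) on `(0,∞)`, continuous on `[0,∞)`,
with `v 0 = α` and `v' 0 = 0`. -/
def IVPsol (n : ℕ) (f : ℝ → ℝ) (α : ℝ) (v : ℝ → ℝ) : Prop :=
  v 0 = α ∧ deriv v 0 = 0 ∧ ContinuousOn v (Ici 0) ∧
    (∀ r : ℝ, 0 < r → DifferentiableAt ℝ v r ∧ DifferentiableAt ℝ (deriv v) r) ∧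
    (∀ r : ℝ, 0 < r → deriv (deriv v) r + ((n : ℝ) - 1) / r * deriv v r + f (v r) = 0)

/-- The family `α ↦ u α` of solutions of the IVP, with `u α r` and `u' α r`
continuous in `(α, r)`. -/
def Family (n : ℕ) (f : ℝ → ℝ) (u : ℝ → ℝ → ℝ) : Prop :=
  (∀ α : ℝ, 0 < α → IVPsol n f α (u α)) ∧
    ContinuousOn (fun p : ℝ × ℝ => u p.1 p.2) (Ioi 0 ×ˢ Ici 0) ∧
    ContinuousOn (fun p : ℝ × ℝ => deriv (u p.1) p.2) (Ioi 0 ×ˢ Ici 0)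

/-- The set whose supremum is `Z_k α`, given `T = T_{k-1} α`. -/
def ZsetAux (u : ℝ → ℝ → ℝ) (k : ℕ) (T α : ℝ) : Set ℝ :=
  {r | T < r ∧ ∀ s ∈ Ioo T r, (-1 : ℝ) ^ k * u α s < 0 ∧ 0 < (-1 : ℝ) ^ k * deriv (u α) s}

/-- The pair `(Z_k, T_k)`, with `T₀ = 0`;
`Z_k α = sup {r > T_{k-1} α | (-1)^k u < 0, (-1)^k u' > 0 on (T_{k-1} α, r)}` and
`T_k α = inf {r > Z_k α | u'(r, α) = 0}`. -/
def ZT (u : ℝ → ℝ → ℝ) : ℕ → (ℝ → ℝ) × (ℝ → ℝ)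
  | 0 => (fun _ => 0, fun _ => 0)
  | k + 1 =>
    let Z : ℝ → ℝ := fun α => sSup (ZsetAux u (k + 1) ((ZT u k).2 α) α)
    (Z, fun α => sInf {r | Z α < r ∧ deriv (u α) r = 0})

/-- `Z_k α` (as a real number; the genuine value when the defining set is bounded above). -/
def Zk (u : ℝ → ℝ → ℝ) (k : ℕ) (α : ℝ) : ℝ := (ZT u k).1 α

/-- `T_k α`, with `T₀ = 0`. -/
def Tk (u : ℝ → ℝ → ℝ) (k : ℕ) (α : ℝ) : ℝ := (ZT u k).2 α

/-- The defining set of `Z_k α`; `Z_k α = ∞` iff this set is unbounded above. -/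
def ZsetK (u : ℝ → ℝ → ℝ) (k : ℕ) (α : ℝ) : Set ℝ := ZsetAux u k (Tk u (k - 1) α) α

open Classical in
/-- The value of `u (·, α)` at `Z_k α`, as a limit `r → ∞` when `Z_k α = ∞`. -/
def uAtZ (u : ℝ → ℝ → ℝ) (k : ℕ) (α : ℝ) : ℝ :=
  if BddAbove (ZsetK u k α) then u α (Zk u k α) else limUnder atTop (u α)

open Classical in
/-- The value of `u' (·, α)` at `Z_k α`, as a limit `r → ∞` when `Z_k α = ∞`. -/
def duAtZ (u : ℝ → ℝ → ℝ) (k : ℕ) (α : ℝ) : ℝ :=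
  if BddAbove (ZsetK u k α) then deriv (u α) (Zk u k α) else limUnder atTop (deriv (u α))

open Classical in
/-- `Z_k α` as an extended real number. -/
def ZkE (u : ℝ → ℝ → ℝ) (k : ℕ) (α : ℝ) : WithTop ℝ :=
  if BddAbove (ZsetK u k α) then (Zk u k α : WithTop ℝ) else ⊤

/-- Membership in `F̃_k` (for `α ∈ N_{k-1}`): `(-1)^k u' (r, α) < 0` for all `r > Z_{k-1} α`. -/
def Ftil (u : ℝ → ℝ → ℝ) (k : ℕ) (α : ℝ) : Prop :=
  ∀ r, Zk u (k - 1) α < r → (-1 : ℝ) ^ k * deriv (u α) r < 0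

/-- The sets `N_k` (with `N₀ := (0,∞)`). -/
def Nk (u : ℝ → ℝ → ℝ) : ℕ → Set ℝ
  | 0 => Ioi 0
  | 1 => {α | 0 < α ∧ uAtZ u 1 α = 0 ∧ duAtZ u 1 α < 0}
  | k + 2 => {α | α ∈ Nk u (k + 1) ∧ ¬Ftil u (k + 2) α ∧ uAtZ u (k + 2) α = 0 ∧
      0 < (-1 : ℝ) ^ (k + 2) * duAtZ u (k + 2) α}

/-- The sets `G_k`. -/
def Gk (u : ℝ → ℝ → ℝ) : ℕ → Set ℝ
  | 0 => ∅
  | 1 => {α | 0 < α ∧ uAtZ u 1 α = 0 ∧ duAtZ u 1 α = 0}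
  | k + 2 => {α | α ∈ Nk u (k + 1) ∧ ¬Ftil u (k + 2) α ∧ uAtZ u (k + 2) α = 0 ∧
      duAtZ u (k + 2) α = 0}

/-- The set `F̃_k` (for `k ≥ 2`). -/
def FtilSet (u : ℝ → ℝ → ℝ) (k : ℕ) : Set ℝ := {α | α ∈ Nk u (k - 1) ∧ Ftil u k α}

/-- The set `F_k` (for `k ≥ 2`). -/
def Fk (u : ℝ → ℝ → ℝ) (k : ℕ) : Set ℝ :=
  {α | α ∈ Nk u (k - 1) ∧ ¬Ftil u k α ∧ (-1 : ℝ) ^ k * uAtZ u k α < 0}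

/-- The sets `P_k`. -/
def Pk (u : ℝ → ℝ → ℝ) : ℕ → Set ℝ
  | 0 => ∅
  | 1 => {α | 0 < α ∧ 0 < uAtZ u 1 α}
  | k + 2 => FtilSet u (k + 2) ∪ Fk u (k + 2)

/-- The set of extremal points (zeros of `u' (·, α)`) in `[0, A]`. -/
def ExtSet (u : ℝ → ℝ → ℝ) (α A : ℝ) : Set ℝ := {r | r ∈ Icc 0 A ∧ deriv (u α) r = 0}

/-- The conclusion of the δ₁-lemma (Lemma 4.1): every solution with initial value in
`(α*-δ₁, α*+δ₁)` has exactly `k` extremal points in `[0, T_{k-1}(α*) + a]`, with minimum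
values `< -β` and maximum values `> β`; moreover any two such solutions intersect between
any two of their consecutive extremal points, and in `(T_{k-1}(α*), Z_k(α*))`. -/
def DeltaOneLemma (f : ℝ → ℝ) (β : ℝ) (u : ℝ → ℝ → ℝ) (k : ℕ) (αs a δ₁ : ℝ) : Prop :=
  0 < a ∧ 0 < δ₁ ∧
    (∀ α ∈ Ioo (αs - δ₁) (αs + δ₁),
      (ExtSet u α (Tk u (k - 1) αs + a)).Finite ∧
        (ExtSet u α (Tk u (k - 1) αs + a)).ncard = k ∧
        ∀ r ∈ ExtSet u α (Tk u (k - 1) αs + a),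
          (IsLocalMin (u α) r → u α r < -β) ∧ (IsLocalMax (u α) r → β < u α r)) ∧
    ∀ α₁ ∈ Ioo (αs - δ₁) (αs + δ₁), ∀ α₂ ∈ Ioo (αs - δ₁) (αs + δ₁), α₁ < α₂ →
      (∀ i : ℕ, 1 ≤ i → i ≤ k - 1 →
        ∃ t, max (Tk u (i - 1) α₁) (Tk u (i - 1) α₂) < t ∧
          t < min (Tk u i α₁) (Tk u i α₂) ∧ u α₁ t = u α₂ t) ∧
      ∃ t, Tk u (k - 1) αs < t ∧ (BddAbove (ZsetK u k αs) → t < Zk u k αs) ∧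
        u α₁ t = u α₂ t

/-- `ρ` is the inverse of the monotone branch of `v` on `[t₁, t₂]`, whose set of values
is `[m, M]`. -/
def InvBranch (v ρ : ℝ → ℝ) (t₁ t₂ m M : ℝ) : Prop :=
  (∀ s ∈ Icc m M, ρ s ∈ Icc t₁ t₂ ∧ v (ρ s) = s) ∧
    ∀ s ∈ Ioo m M, HasDerivAt ρ (1 / deriv v (ρ s)) s

/-- `ρ` inverts a decreasing branch of `v` over the value interval `[m, M]`, along which
`(v')² + 2F > 0`. -/
def DecBranchInv (f : ℝ → ℝ) (v ρ : ℝ → ℝ) (m M : ℝ) : Prop :=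
  ∀ s ∈ Icc m M, 0 ≤ ρ s ∧ v (ρ s) = s ∧ deriv v (ρ s) < 0 ∧
    HasDerivAt ρ (1 / deriv v (ρ s)) s ∧ 0 < (deriv v (ρ s)) ^ 2 + 2 * Fint f s

/-- The functional `Q(s) = -4 (F/f)(s) r/r' - r²/(r')² - 2 r² F(s) + H(s)` computed along
the branch inverse `ρ`. -/
def Qfun (f H ρ : ℝ → ℝ) (s : ℝ) : ℝ :=
  -4 * (Fint f s / f s) * (ρ s / deriv ρ s) - (ρ s) ^ 2 / (deriv ρ s) ^ 2 -
    2 * (ρ s) ^ 2 * Fint f s + H s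

/-- The functional `P(s) = -2n (F/f)(s) r^{n-1}/r' - r^n/(r')² - 2 r^n F(s)`. -/
def Pfun (n : ℕ) (f : ℝ → ℝ) (ρ : ℝ → ℝ) (s : ℝ) : ℝ :=
  -(2 * (n : ℝ)) * (Fint f s / f s) * (ρ s ^ (n - 1) / deriv ρ s) -
    ρ s ^ n / (deriv ρ s) ^ 2 - 2 * ρ s ^ n * Fint f s

/-- The functional `W(s) = r(s) √((u'(r(s)))² + 2 F(s))`. -/
def Wfun (f v ρ : ℝ → ℝ) (s : ℝ) : ℝ :=
  ρ s * Real.sqrt ((deriv v (ρ s)) ^ 2 + 2 * Fint f s)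

/-- The functional `W̃(s) = r(s)^{n-1} √((u'(r(s)))² + 2 F(s))`. -/
def Wtil (n : ℕ) (f : ℝ → ℝ) (v ρ : ℝ → ℝ) (s : ℝ) : ℝ :=
  ρ s ^ (n - 1) * Real.sqrt ((deriv v (ρ s)) ^ 2 + 2 * Fint f s)

/-- `v` changes sign at `z ∈ (0,∞)`: `v z = 0` and `v` takes both signs in every
neighborhood of `z` (within `(0,∞)`). -/
def SignChange (v : ℝ → ℝ) (z : ℝ) : Prop :=
  v z = 0 ∧ ∀ ε : ℝ, 0 < ε →
    (∃ x ∈ Ioo (z - ε) (z + ε) ∩ Ioi 0, 0 < v x) ∧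
    (∃ x ∈ Ioo (z - ε) (z + ε) ∩ Ioi 0, v x < 0)

/-- `v` has exactly `m` sign changes in `(0,∞)`. -/
def ExactSignChanges (v : ℝ → ℝ) (m : ℕ) : Prop :=
  {z | 0 < z ∧ SignChange v z}.Finite ∧ {z | 0 < z ∧ SignChange v z}.ncard = m

/-- Bound state: a C² solution of (E) on `(0,∞)` with `v' 0 = 0` and `v r → 0` as `r → ∞`. -/
def BoundState (n : ℕ) (f : ℝ → ℝ) (v : ℝ → ℝ) : Prop :=
  ContinuousOn v (Ici 0) ∧
    (∀ r : ℝ, 0 < r → DifferentiableAt ℝ v r ∧ DifferentiableAt ℝ (deriv v) r) ∧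
    (∀ r : ℝ, 0 < r → deriv (deriv v) r + ((n : ℝ) - 1) / r * deriv v r + f (v r) = 0) ∧
    deriv v 0 = 0 ∧ Tendsto v atTop (nhds 0)

/-- Solution of the Dirichlet problem on the ball of radius `R`. -/
def DirichletSol (n : ℕ) (f : ℝ → ℝ) (R : ℝ) (v : ℝ → ℝ) : Prop :=
  ContinuousOn v (Icc 0 R) ∧
    (∀ r ∈ Ioo (0:ℝ) R, DifferentiableAt ℝ v r ∧ DifferentiableAt ℝ (deriv v) r) ∧
    (∀ r ∈ Ioo (0:ℝ) R, deriv (deriv v) r + ((n : ℝ) - 1) / r * deriv v r + f (v r) = 0) ∧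
    deriv v 0 = 0 ∧ v R = 0

end
end Paper

open Paper Set Filter MeasureTheory

/-- If `s f'(s) ≤ f(s)` for `s > 0`, then `s ↦ f(s) / s` is nonincreasing on `(0,∞)`. -/
theorem antitoneOn_div_of_mul_deriv_le {f : ℝ → ℝ}
    (hdiff : ∀ s : ℝ, 0 < s → DifferentiableAt ℝ f s)
    (hle : ∀ s : ℝ, 0 < s → s * deriv f s ≤ f s) :
    AntitoneOn (fun s => f s / s) (Ioi 0) := by
  have hderiv : ∀ s : ℝ, 0 < s →
      HasDerivAt (fun s => f s / s) ((deriv f s * s - f s * 1) / s ^ 2) s := fun s hs =>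
    (hdiff s hs).hasDerivAt.div (hasDerivAt_id s) hs.ne'
  refine antitoneOn_of_deriv_nonpos (convex_Ioi 0)
    (fun s hs => (hderiv s hs).continuousAt.continuousWithinAt) ?_ ?_ <;>
    rw [interior_Ioi] <;> intro s hs
  · exact (hderiv s hs).differentiableAt.differentiableWithinAt
  · rw [(hderiv s hs).deriv]
    exact div_nonpos_of_nonpos_of_nonneg (by linarith [hle s hs]) (sq_nonneg s)

/-- No function satisfies the Riccati inequality `κ (1 + w²) ≤ w'` with `κ > 0` on a
half-line. -/
theorem riccati_blowup {w w' : ℝ → ℝ} {κ R : ℝ} (hκ : 0 < κ)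
    (hw : ∀ r, R ≤ r → HasDerivAt w (w' r) r)
    (hle : ∀ r, R ≤ r → κ * (1 + w r ^ 2) ≤ w' r) : False := by
  have hderiv : ∀ r, R ≤ r →
      HasDerivAt (fun r => Real.arctan (w r)) (1 / (1 + w r ^ 2) * w' r) r :=
    fun r hr => (hw r hr).arctan
  have hgrowth : κ * (R + Real.pi / κ - R) ≤
      Real.arctan (w (R + Real.pi / κ)) - Real.arctan (w R) := by
    have hpos : 0 ≤ Real.pi / κ := by positivity
    refine (convex_Ici R).mul_sub_le_image_sub_of_le_deriv
      (f := fun r => Real.arctan (w r))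
      (fun r hr => (hderiv r hr).continuousAt.continuousWithinAt) ?_ ?_
      R (mem_Ici.2 le_rfl) (R + Real.pi / κ) (by simpa using hpos) (by linarith) <;>
      rw [interior_Ici] <;> intro r hr
    · exact (hderiv r (le_of_lt hr)).differentiableAt.differentiableWithinAt
    · rw [(hderiv r (le_of_lt hr)).deriv, one_div, inv_mul_eq_div, le_div_iff₀ (by positivity)]
      exact hle r (le_of_lt hr)
  have hpi : κ * (R + Real.pi / κ - R) = Real.pi := by field_simp; ring
  linarith [Real.arctan_lt_pi_div_two (w (R + Real.pi / κ)), Real.neg_pi_div_two_lt_arctan (w R)]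

/-- Under (f1'), (f2'), (f3') (with `f` odd) and `(F/f)' ≥ (n-2)/(2n)` on `(0,∞)`, there
is no nonconstant bound state of (E) with finitely many zeros in `(0,∞)`. -/
theorem no_bound_state_positive_f
    (n : ℕ) (hn : 2 ≤ n)
    (f : ℝ → ℝ) (hf : Continuous f) (hodd : ∀ s, f (-s) = -f s)
    (h1 : Hf1' f) (h2 : Hf2 f) (h3 : Hf3' f)
    (h4 : ∀ s : ℝ, 0 < s →
      ((n : ℝ) - 2) / (2 * (n : ℝ)) ≤ deriv (fun t => Fint f t / f t) s)
    (u : ℝ → ℝ) (hu : BoundState n f u)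
    (hnonconst : ∃ r₁ ∈ Ici (0:ℝ), ∃ r₂ ∈ Ici (0:ℝ), u r₁ ≠ u r₂)
    (hfin : {r : ℝ | 0 < r ∧ u r = 0}.Finite) :
    False := by
  obtain ⟨-, hdiff, heq, -, hlim⟩ := hu
  have hf1 : 0 < f 1 := by simpa using h1.2 1 one_pos
  have hquot : ∀ s : ℝ, s ≠ 0 → |s| ≤ 1 → f 1 ≤ f s / s := by
    have hpos : ∀ s : ℝ, 0 < s → s ≤ 1 → f 1 ≤ f s / s := fun s hs hs1 => by
      simpa using antitoneOn_div_of_mul_deriv_le h2.2.1 h3.1 hs (mem_Ioi.2 one_pos) hs1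
    intro s hs hs1
    rcases hs.lt_or_gt with hneg | hs0
    · simpa [hodd] using hpos (-s) (by linarith) (by rwa [abs_of_neg hneg] at hs1)
    · exact hpos s hs0 (by rwa [abs_of_pos hs0] at hs1)
  set c := min (f 1) 1
  have hc0 : 0 < c := lt_min hf1 one_pos
  have hdamp : Tendsto (fun r : ℝ => ((n : ℝ) - 1) / r) atTop (nhds 0) :=
    tendsto_const_nhds.div_atTop tendsto_id
  obtain ⟨B, hB⟩ := hfin.bddAbove
  have hsmall : ∀ᶠ r in atTop, |u r| < 1 := by
    simpa using hlim.abs.eventually_lt_const (by simp : |(0 : ℝ)| < 1)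
  have hdamp_small : ∀ᶠ r : ℝ in atTop, |((n : ℝ) - 1) / r| < c := by
    simpa using hdamp.abs.eventually_lt_const (by simpa using hc0)
  obtain ⟨R, hR⟩ := eventually_atTop.1
    ((eventually_gt_atTop 0).and ((eventually_gt_atTop B).and (hsmall.and hdamp_small)))
  have hne : ∀ r, R ≤ r → u r ≠ 0 := fun r hr h0 =>
    ((hR r hr).2.1).not_ge (hB ⟨(hR r hr).1, h0⟩)
  refine riccati_blowup (w := fun r => -(deriv u r / u r))
    (w' := fun r => -((deriv (deriv u) r * u r - deriv u r * deriv u r) / u r ^ 2))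
    (κ := c / 2) (R := R) (by positivity) (fun r hr => ?_) (fun r hr => ?_)
  · obtain ⟨hu1, hu2⟩ := hdiff r (hR r hr).1
    exact (hu2.hasDerivAt.div hu1.hasDerivAt (hne r hr)).neg
  · obtain ⟨hr0, -, hu1, he⟩ := hR r hr
    have hu0 := hne r hr
    have hq := hquot (u r) hu0 hu1.le
    have hode : deriv (deriv u) r = -(((n : ℝ) - 1) / r * deriv u r) - f (u r) := by
      linarith [heq r hr0]
    simp only [hode]
    generalize ((n : ℝ) - 1) / r = e at he
    have hw : -(((-(e * deriv u r) - f (u r)) * u r - deriv u r * deriv u r) / u r ^ 2) =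
        e * (deriv u r / u r) + f (u r) / u r + (deriv u r / u r) ^ 2 := by
      field_simp
      ring
    rw [hw, neg_sq]
    generalize deriv u r / u r = w
    have hcf : c ≤ f 1 := min_le_left _ _
    have hc1 : c ≤ 1 := min_le_right _ _
    obtain ⟨he1, he2⟩ := abs_lt.1 he
    have he3 : e ^ 2 ≤ c := by nlinarith
    nlinarith [sq_nonneg (w + e), mul_nonneg (sub_nonneg.2 hc1) (sq_nonneg w)]
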